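/- Let Ψ = {A_1, …, A_m} be a finite set of nonnegative n×n matrices, at least one of which is nonzero. Then every w ∈ C_Ψ = C_{Ψ,μ̂(Ψ)} is a weak Pareto optimal point for the error functions e_{A_1}, …, e_{A_m}: there is no x ∈ int(ℝ^n_+) with e_{A_i}(x) < e_{A_i}(w) for all i = 1,…,m. -/

import Mathlib

open Filter Relation

namespace MaxAlg

/-- Max-algebraic action of a matrix on a vector: `(A ⊗ x) i = max_j A i j * x j`. -/
noncomputable def maxVec {n : ℕ} (A : Fin n → Fin n → ℝ) (x : Fin n → ℝ) : Fin n → ℝ :=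
  fun i => ⨆ j, A i j * x j

/-- Max-algebraic matrix product: `(A ⊗ B) i k = max_j A i j * B j k`. -/
noncomputable def maxMul {n : ℕ} (A B : Fin n → Fin n → ℝ) : Fin n → Fin n → ℝ :=
  fun i k => ⨆ j, A i j * B j k

/-- The weight of the cycle determined by a list `[i₁, …, i_k]`,
namely `A i₁ i₂ * ⋯ * A i_{k-1} i_k * A i_k i₁`. -/
noncomputable def cycleProd {n : ℕ} (A : Fin n → Fin n → ℝ) (l : List (Fin n)) : ℝ :=
  ((l.zip (l.rotate 1)).map fun p => A p.1 p.2).prod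

/-- The maximal cycle geometric mean of `A`: the supremum over all cycles of distinct
nodes of the k-th root of the cycle weight. -/
noncomputable def mu {n : ℕ} (A : Fin n → Fin n → ℝ) : ℝ :=
  sSup {c | ∃ l : List (Fin n), l ≠ [] ∧ l.Nodup ∧ c = cycleProd A l ^ ((l.length : ℝ)⁻¹)}

/-- `C_{A,r}`: the positive vectors with `A ⊗ x ≤ r x`. -/
def Cset {n : ℕ} (A : Fin n → Fin n → ℝ) (r : ℝ) : Set (Fin n → ℝ) :=
  {x | (∀ i, 0 < x i) ∧ ∀ i, maxVec A x i ≤ r * x i}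

/-- A critical cycle: a cycle of distinct nodes attaining `mu A`. -/
def IsCriticalCycle {n : ℕ} (A : Fin n → Fin n → ℝ) (l : List (Fin n)) : Prop :=
  l ≠ [] ∧ l.Nodup ∧ cycleProd A l ^ ((l.length : ℝ)⁻¹) = mu A

/-- `(i,j) ∈ E^C(A)`: the edge `(i,j)` lies on some critical cycle. -/
def criticalEdge {n : ℕ} (A : Fin n → Fin n → ℝ) (i j : Fin n) : Prop :=
  ∃ l : List (Fin n), IsCriticalCycle A l ∧ (i, j) ∈ l.zip (l.rotate 1)

/-- `i ∈ N^C(A)`: the node `i` lies on some critical cycle. -/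
def criticalNode {n : ℕ} (A : Fin n → Fin n → ℝ) (i : Fin n) : Prop :=
  ∃ l : List (Fin n), IsCriticalCycle A l ∧ i ∈ l

/-- Irreducibility: the digraph of `A` (edge `(i,j)` iff `A i j > 0`) is strongly connected. -/
def Irred {n : ℕ} (A : Fin n → Fin n → ℝ) : Prop :=
  ∀ i j, Relation.ReflTransGen (fun a b => 0 < A a b) i j

/-- Max-algebraic product of a word of matrices from the family `A`. -/
noncomputable def wordProd {n m : ℕ} (A : Fin m → Fin n → Fin n → ℝ) :
    List (Fin m) → (Fin n → Fin n → ℝ)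
  | [] => fun i j => if i = j then 1 else 0
  | [j] => A j
  | j :: k :: w => maxMul (A j) (wordProd A (k :: w))

/-- The max version of the generalised spectral radius
`μ̂(Ψ) = limsup_{p→∞} (max_{ψ ∈ Ψ^p_⊗} μ(ψ))^{1/p}`. -/
noncomputable def genSpecRad {n m : ℕ} (A : Fin m → Fin n → Fin n → ℝ) : ℝ :=
  Filter.limsup
    (fun p : ℕ =>
      (sSup {c | ∃ w : List (Fin m), w.length = p ∧ c = mu (wordProd A w)}) ^ ((p : ℝ)⁻¹))
    Filter.atTop

/-- `S = A₁ ⊕ ⋯ ⊕ A_m`: the entrywise maximum of the family. -/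
noncomputable def Smat {n m : ℕ} (A : Fin m → Fin n → Fin n → ℝ) : Fin n → Fin n → ℝ :=
  fun i j => ⨆ k, A k i j

/-- The relative error function `e_A(x) = max_{i,j} A i j * x j / x i`. -/
noncomputable def errF {n : ℕ} (A : Fin n → Fin n → ℝ) (x : Fin n → ℝ) : ℝ :=
  ⨆ i, ⨆ j, A i j * x j / x i

/-- A symmetrically reciprocal (SR) matrix: positive, with unit diagonal and
`A i j * A j i = 1` for `i ≠ j`. -/
def IsSR {n : ℕ} (A : Fin n → Fin n → ℝ) : Prop :=
  (∀ i j, 0 < A i j) ∧ (∀ i, A i i = 1) ∧ ∀ i j, i ≠ j → A i j * A j i = 1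

/-- Max-algebraic matrix powers. -/
noncomputable def maxPow {n : ℕ} (B : Fin n → Fin n → ℝ) : ℕ → (Fin n → Fin n → ℝ)
  | 0 => fun i j => if i = j then 1 else 0
  | p + 1 => maxMul B (maxPow B p)

/-- The Kleene star `B* = I ⊕ B ⊕ B⊗² ⊕ ⋯ ⊕ B⊗^{n-1}`. -/
noncomputable def kleeneStar {n : ℕ} (B : Fin n → Fin n → ℝ) : Fin n → Fin n → ℝ :=
  fun i j => ⨆ p : Fin n, maxPow B p i j

/-- Along two lists of equal length, a matrix with `B i j * x j ≤ r * x i` has edge product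
at most `r ^ length`, up to the products of the entries of `x`. -/
theorem prod_zip_mul_prod_le {n : ℕ} {B : Fin n → Fin n → ℝ} {x : Fin n → ℝ} {r : ℝ}
    (hB : ∀ i j, 0 ≤ B i j) (hr : 0 ≤ r) (hx : ∀ i, 0 < x i)
    (h : ∀ i j, B i j * x j ≤ r * x i) :
    ∀ l l' : List (Fin n), l.length = l'.length →
      ((l.zip l').map fun p => B p.1 p.2).prod * (l'.map x).prod
        ≤ r ^ l.length * (l.map x).prod
  | [], [], _ => by simp
  | [], _ :: _, hl => by simp at hl
  | _ :: _, [], hl => by simp at hl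
  | a :: l, b :: l', hl => by
    have ih := prod_zip_mul_prod_le hB hr hx h l l' (by simpa using hl)
    have h1 : 0 ≤ ((l.zip l').map fun p => B p.1 p.2).prod :=
      List.prod_nonneg (by simp only [List.mem_map]; rintro _ ⟨p, -, rfl⟩; exact hB _ _)
    have h2 : 0 ≤ (l'.map x).prod :=
      List.prod_nonneg (by simp only [List.mem_map]; rintro _ ⟨p, -, rfl⟩; exact (hx _).le)
    simp only [List.zip_cons_cons, List.map_cons, List.prod_cons, List.length_cons, pow_succ]
    calc _ = (B a b * x b) *
          (((l.zip l').map fun p => B p.1 p.2).prod * (l'.map x).prod) := by ring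
      _ ≤ (r * x a) * (r ^ l.length * (l.map x).prod) :=
          mul_le_mul (h a b) ih (mul_nonneg h1 h2) (mul_nonneg hr (hx a).le)
      _ = _ := by ring

theorem cycleProd_nonneg {n : ℕ} {B : Fin n → Fin n → ℝ} (hB : ∀ i j, 0 ≤ B i j)
    (l : List (Fin n)) : 0 ≤ cycleProd B l :=
  List.prod_nonneg (by simp only [List.mem_map]; rintro _ ⟨p, -, rfl⟩; exact hB _ _)

theorem cycleProd_le_pow {n : ℕ} {B : Fin n → Fin n → ℝ} {x : Fin n → ℝ} {r : ℝ}
    (hB : ∀ i j, 0 ≤ B i j) (hr : 0 ≤ r) (hx : ∀ i, 0 < x i)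
    (h : ∀ i j, B i j * x j ≤ r * x i) (l : List (Fin n)) :
    cycleProd B l ≤ r ^ l.length := by
  have key := prod_zip_mul_prod_le hB hr hx h l (l.rotate 1) (by simp)
  rw [((l.rotate_perm 1).map x).prod_eq] at key
  refine le_of_mul_le_mul_right key (List.prod_pos ?_)
  simp only [List.mem_map]
  rintro _ ⟨p, -, rfl⟩
  exact hx p

/-- A positive vector `x` with `B ⊗ x ≤ r x` bounds the maximal cycle geometric mean by `r`. -/
theorem mu_le {n : ℕ} {B : Fin n → Fin n → ℝ} {x : Fin n → ℝ} {r : ℝ}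
    (hB : ∀ i j, 0 ≤ B i j) (hr : 0 ≤ r) (hx : ∀ i, 0 < x i)
    (h : ∀ i j, B i j * x j ≤ r * x i) : mu B ≤ r := by
  refine Real.sSup_le ?_ hr
  rintro _ ⟨l, hl, -, rfl⟩
  calc cycleProd B l ^ ((l.length : ℝ)⁻¹)
      ≤ (r ^ l.length) ^ ((l.length : ℝ)⁻¹) :=
        Real.rpow_le_rpow (cycleProd_nonneg hB l) (cycleProd_le_pow hB hr hx h l) (by positivity)
    _ = r := Real.pow_rpow_inv_natCast hr (by simpa using hl)

theorem mu_nonneg {n : ℕ} {B : Fin n → Fin n → ℝ} (hB : ∀ i j, 0 ≤ B i j) : 0 ≤ mu B := by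
  refine Real.sSup_nonneg ?_
  rintro _ ⟨l, -, -, rfl⟩
  exact Real.rpow_nonneg (cycleProd_nonneg hB l) _

theorem wordProd_nonneg {n m : ℕ} {A : Fin m → Fin n → Fin n → ℝ}
    (hA : ∀ k i j, 0 ≤ A k i j) : ∀ (v : List (Fin m)) (i j : Fin n), 0 ≤ wordProd A v i j
  | [], i, j => by
    simp only [wordProd]
    split_ifs <;> norm_num
  | [k], i, j => hA k i j
  | k :: k' :: v, i, j =>
    Real.iSup_nonneg fun l => mul_nonneg (hA k i l) (wordProd_nonneg hA (k' :: v) l j)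

/-- A common subeigenvector of the family is a subeigenvector of every word in it. -/
theorem wordProd_mul_le {n m : ℕ} {A : Fin m → Fin n → Fin n → ℝ} {x : Fin n → ℝ} {s : ℝ}
    (hA : ∀ k i j, 0 ≤ A k i j) (hs : 0 ≤ s) (hx : ∀ i, 0 < x i)
    (h : ∀ k i j, A k i j * x j ≤ s * x i) :
    ∀ (v : List (Fin m)), v ≠ [] → ∀ i j, wordProd A v i j * x j ≤ s ^ v.length * x i
  | [], hv, _, _ => absurd rfl hv
  | [k], _, i, j => by simpa [wordProd] using h k i j
  | k :: k' :: v, _, i, j => by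
    rw [← le_div_iff₀ (hx j)]
    refine Real.iSup_le (fun l => ?_)
      (div_nonneg (mul_nonneg (pow_nonneg hs _) (hx i).le) (hx j).le)
    rw [le_div_iff₀ (hx j)]
    have ih := wordProd_mul_le hA hs hx h (k' :: v) (by simp) l j
    calc A k i l * wordProd A (k' :: v) l j * x j
        = A k i l * (wordProd A (k' :: v) l j * x j) := by ring
      _ ≤ A k i l * (s ^ (k' :: v).length * x l) := mul_le_mul_of_nonneg_left ih (hA k i l)
      _ = s ^ (k' :: v).length * (A k i l * x l) := by ring
      _ ≤ s ^ (k' :: v).length * (s * x i) :=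
          mul_le_mul_of_nonneg_left (h k i l) (pow_nonneg hs _)
      _ = s ^ (k :: k' :: v).length * x i := by
          rw [List.length_cons (as := k' :: v), pow_succ]; ring

theorem genSpecRad_le {n m : ℕ} {A : Fin m → Fin n → Fin n → ℝ} {x : Fin n → ℝ} {s : ℝ}
    (hA : ∀ k i j, 0 ≤ A k i j) (hs : 0 ≤ s) (hx : ∀ i, 0 < x i)
    (h : ∀ k i j, A k i j * x j ≤ s * x i) : genSpecRad A ≤ s := by
  have hnn : ∀ p : ℕ, 0 ≤ sSup {c | ∃ v : List (Fin m), v.length = p ∧ c = mu (wordProd A v)} := by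
    intro p
    refine Real.sSup_nonneg ?_
    rintro _ ⟨v, -, rfl⟩
    exact mu_nonneg (wordProd_nonneg hA v)
  refine Filter.limsup_le_of_le
    (Filter.isCoboundedUnder_le_of_le atTop fun p => Real.rpow_nonneg (hnn p) _) ?_
  filter_upwards [eventually_gt_atTop 0] with p hp
  calc _ ≤ (s ^ p) ^ ((p : ℝ)⁻¹) := by
        refine Real.rpow_le_rpow (hnn p) (Real.sSup_le ?_ (pow_nonneg hs p)) (by positivity)
        rintro _ ⟨v, rfl, rfl⟩
        exact mu_le (wordProd_nonneg hA v) (pow_nonneg hs _) hx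
          (wordProd_mul_le hA hs hx h v (List.length_pos_iff.mp hp))
    _ = s := Real.pow_rpow_inv_natCast hs hp.ne'

theorem mul_le_errF_mul {n : ℕ} (B : Fin n → Fin n → ℝ) {x : Fin n → ℝ} (hx : ∀ i, 0 < x i)
    (i j : Fin n) : B i j * x j ≤ errF B x * x i := by
  rw [← div_le_iff₀ (hx i)]
  exact (le_ciSup (f := fun j => B i j * x j / x i) (Set.finite_range _).bddAbove j).trans
    (le_ciSup (f := fun i => ⨆ j, B i j * x j / x i) (Set.finite_range _).bddAbove i)

theorem errF_nonneg {n : ℕ} {B : Fin n → Fin n → ℝ} (hB : ∀ i j, 0 ≤ B i j) {x : Fin n → ℝ}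
    (hx : ∀ i, 0 < x i) : 0 ≤ errF B x :=
  Real.iSup_nonneg fun i => Real.iSup_nonneg fun j =>
    div_nonneg (mul_nonneg (hB i j) (hx j).le) (hx i).le

theorem errF_le_of_mem_Cset {n : ℕ} [Nonempty (Fin n)] {B : Fin n → Fin n → ℝ} {w : Fin n → ℝ}
    {r : ℝ} (hw : w ∈ Cset B r) : errF B w ≤ r := by
  refine ciSup_le fun i => ciSup_le fun j => ?_
  rw [div_le_iff₀ (hw.1 i)]
  exact (le_ciSup (f := fun j => B i j * w j) (Set.finite_range _).bddAbove j).trans (hw.2 i)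

/-- every `w ∈ C_Ψ = C_{Ψ,μ̂(Ψ)}` is a weak Pareto optimal point for the
error functions `e_{A_1}, …, e_{A_m}`. -/
theorem stmt15 {n m : ℕ} (hm : 0 < m) (A : Fin m → Fin n → Fin n → ℝ)
    (hA : ∀ k i j, 0 ≤ A k i j) (h0 : ∃ k, A k ≠ 0)
    (w : Fin n → ℝ) (hw : w ∈ ⋂ k, Cset (A k) (genSpecRad A)) :
    ¬∃ x : Fin n → ℝ, (∀ i, 0 < x i) ∧ ∀ k, errF (A k) x < errF (A k) w := by
  rintro ⟨x, hx, hlt⟩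
  obtain ⟨k₀, hk₀⟩ := h0
  obtain ⟨i₀, -⟩ := Function.ne_iff.mp hk₀
  have : Nonempty (Fin n) := ⟨i₀⟩
  have : Nonempty (Fin m) := ⟨⟨0, hm⟩⟩
  obtain ⟨k, hk⟩ := Finite.exists_max fun k => errF (A k) x
  have hle : genSpecRad A ≤ errF (A k) x :=
    genSpecRad_le hA (errF_nonneg (hA k) hx) hx fun k' i j =>
      (mul_le_errF_mul (A k') hx i j).trans (mul_le_mul_of_nonneg_right (hk k') (hx i).le)
  have hge : errF (A k) w ≤ genSpecRad A := errF_le_of_mem_Cset (Set.mem_iInter.mp hw k)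
  exact (hlt k).not_ge (hge.trans hle)

end MaxAlg
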